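/- arXiv:1508.04428 — 2 statements merged into one kernel-verified Lean document; each statement's English description precedes it below -/
import Mathlib

section
/- Let ℒ be a distributive abstract logic with space X, and let F ⊆ X be a nonempty irreducible closed set. Then P := ⋃F (the union of all prime theories belonging to F) is itself a prime theory of ℒ, P ∈ F, and F equals the topological closure of {P}; that is, P is a generic point of F. -/
/-- An abstract logic: a nonempty family of theories on `Expr`
closed under intersections of nonempty subfamilies. -/
def IsAbstractLogic {Expr : Type*} (Th : Set (Set Expr)) : Prop :=
  Th.Nonempty ∧ ∀ 𝒯 ⊆ Th, 𝒯.Nonempty → ⋂₀ 𝒯 ∈ Th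

/-- The logic is closed under chains: the union of every nonempty chain of
theories is a theory. -/
def ChainClosed {Expr : Type*} (Th : Set (Set Expr)) : Prop :=
  ∀ 𝒯 ⊆ Th, 𝒯.Nonempty → IsChain (· ⊆ ·) 𝒯 → ⋃₀ 𝒯 ∈ Th

/-- A theory is totally prime if whenever it is the intersection of a nonempty
family of theories, it belongs to that family. -/
def TotallyPrimeTheory {Expr : Type*} (Th : Set (Set Expr)) (T : Set Expr) : Prop :=
  T ∈ Th ∧ ∀ 𝒯 ⊆ Th, 𝒯.Nonempty → T = ⋂₀ 𝒯 → T ∈ 𝒯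

/-- A theory is prime if whenever it is the intersection of two theories,
it equals one of them. -/
def PrimeTheory {Expr : Type*} (Th : Set (Set Expr)) (T : Set Expr) : Prop :=
  T ∈ Th ∧ ∀ T₁ ∈ Th, ∀ T₂ ∈ Th, T = T₁ ∩ T₂ → T = T₁ ∨ T = T₂

/-- A distributive abstract logic: an abstract logic closed under chains with
binary operations `vee` (disjunction) and `wedge` (conjunction) behaving as
expected on all totally prime theories. -/
def IsDistributiveLogic {Expr : Type*} (Th : Set (Set Expr))
    (vee wedge : Expr → Expr → Expr) : Prop :=
  IsAbstractLogic Th ∧ ChainClosed Th ∧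
  (∀ T, TotallyPrimeTheory Th T → ∀ a b, vee a b ∈ T ↔ (a ∈ T ∨ b ∈ T)) ∧
  (∀ T, TotallyPrimeTheory Th T → ∀ a b, wedge a b ∈ T ↔ (a ∈ T ∧ b ∈ T))

/-- The space of a distributive abstract logic: the set of its prime theories. -/
structure LogicSpace {Expr : Type*} (Th : Set (Set Expr)) where
  val : Set Expr
  prime : PrimeTheory Th val

/-- The basic open set `a^X = { P ∈ PTh | a ∈ P }`. -/
def basicSet {Expr : Type*} (Th : Set (Set Expr)) (a : Expr) : Set (LogicSpace Th) :=
  {P | a ∈ P.val}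

/-- The topology on the space of prime theories generated by the base
`Λ(X) = { a^X | a ∈ Expr }`. -/
instance {Expr : Type*} (Th : Set (Set Expr)) : TopologicalSpace (LogicSpace Th) :=
  TopologicalSpace.generateFrom (Set.range (basicSet Th))

/-- In a chain closed logic, every expression outside a theory `T` is omitted by some
totally prime theory extending `T`. -/
theorem ChainClosed.exists_totallyPrimeTheory {Expr : Type*} {Th : Set (Set Expr)}
    (hC : ChainClosed Th) {T : Set Expr} (hT : T ∈ Th) {a : Expr} (ha : a ∉ T) :
    ∃ M, TotallyPrimeTheory Th M ∧ T ⊆ M ∧ a ∉ M := by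
  obtain ⟨M, hTM, hM⟩ := zorn_subset_nonempty {S | S ∈ Th ∧ a ∉ S}
    (fun c hc hchain hne => ⟨⋃₀ c,
      ⟨hC c (fun S hS => (hc hS).1) hne hchain, by
        rintro ⟨S, hS, haS⟩
        exact (hc hS).2 haS⟩,
      fun S hS => Set.subset_sUnion_of_mem hS⟩) T ⟨hT, ha⟩
  refine ⟨M, ⟨hM.prop.1, fun 𝒯 h𝒯 _ hM𝒯 => ?_⟩, hTM, hM.prop.2⟩
  have haM : a ∉ ⋂₀ 𝒯 := hM𝒯 ▸ hM.prop.2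
  simp only [Set.mem_sInter, not_forall] at haM
  obtain ⟨S, hS, haS⟩ := haM
  have hMS : M ⊆ S := hM𝒯 ▸ Set.sInter_subset_of_mem hS
  rwa [hMS.antisymm (hM.le_of_ge ⟨h𝒯 hS, haS⟩ hMS)]

/-- A theory containing one of two expressions contains their disjunction. -/
theorem IsDistributiveLogic.vee_mem {Expr : Type*} {Th : Set (Set Expr)}
    {vee wedge : Expr → Expr → Expr} (hD : IsDistributiveLogic Th vee wedge)
    {T : Set Expr} (hT : T ∈ Th) {a b : Expr} (h : a ∈ T ∨ b ∈ T) : vee a b ∈ T := by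
  by_contra hab
  obtain ⟨M, hM, hTM, habM⟩ := hD.2.1.exists_totallyPrimeTheory hT hab
  exact habM ((hD.2.2.1 M hM a b).2 (h.imp (@hTM a) (@hTM b)))

/-- A prime theory containing a disjunction contains one of the disjuncts. -/
theorem IsDistributiveLogic.mem_or_mem_of_vee_mem {Expr : Type*} {Th : Set (Set Expr)}
    {vee wedge : Expr → Expr → Expr} (hD : IsDistributiveLogic Th vee wedge)
    {Q : Set Expr} (hQ : PrimeTheory Th Q) {a b : Expr} (hab : vee a b ∈ Q) :
    a ∈ Q ∨ b ∈ Q := by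
  by_contra! h
  obtain ⟨⟨_, hTh⟩, hC, hvee, -⟩ := hD
  have key : ∀ M, TotallyPrimeTheory Th M → Q ⊆ M → a ∈ M ∨ b ∈ M :=
    fun M hM hQM => (hvee M hM a b).1 (hQM hab)
  let 𝒯 : Expr → Set (Set Expr) := fun c => {M | TotallyPrimeTheory Th M ∧ Q ⊆ M ∧ c ∈ M}
  have hne_a : (𝒯 a).Nonempty := by
    obtain ⟨M, hM, hQM, hbM⟩ := hC.exists_totallyPrimeTheory hQ.1 h.2
    exact ⟨M, hM, hQM, (key M hM hQM).resolve_right hbM⟩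
  have hne_b : (𝒯 b).Nonempty := by
    obtain ⟨M, hM, hQM, haM⟩ := hC.exists_totallyPrimeTheory hQ.1 h.1
    exact ⟨M, hM, hQM, (key M hM hQM).resolve_left haM⟩
  have hQ_eq : Q = ⋂₀ 𝒯 a ∩ ⋂₀ 𝒯 b := by
    refine Set.Subset.antisymm
      (Set.subset_inter (Set.subset_sInter fun M hM => hM.2.1)
        (Set.subset_sInter fun M hM => hM.2.1)) fun x hx => ?_
    by_contra hxQ
    obtain ⟨M, hM, hQM, hxM⟩ := hC.exists_totallyPrimeTheory hQ.1 hxQ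
    rcases key M hM hQM with haM | hbM
    · exact hxM (hx.1 M ⟨hM, hQM, haM⟩)
    · exact hxM (hx.2 M ⟨hM, hQM, hbM⟩)
  rcases hQ.2 _ (hTh _ (fun M hM => hM.1.1) hne_a) _ (hTh _ (fun M hM => hM.1.1) hne_b) hQ_eq
    with hQa | hQb
  · exact h.1 (hQa ▸ fun M hM => hM.2.2)
  · exact h.2 (hQb ▸ fun M hM => hM.2.2)

/-- In a chain closed abstract logic, a set all of whose finite subsets are contained in a theory
inside the set is itself a theory. -/
theorem IsAbstractLogic.mem_of_forall_finite {Expr : Type*} {Th : Set (Set Expr)}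
    (hA : IsAbstractLogic Th) (hC : ChainClosed Th) {P : Set Expr}
    (hfin : ∀ s ⊆ P, s.Finite → ∃ T ∈ Th, s ⊆ T ∧ T ⊆ P) : P ∈ Th := by
  suffices h : ∀ (κ : Cardinal) (s : Set Expr), Cardinal.mk s = κ → s ⊆ P →
      ∃ T ∈ Th, s ⊆ T ∧ T ⊆ P by
    obtain ⟨T, hT, hPT, hTP⟩ := h _ P rfl subset_rfl
    rwa [hPT.antisymm hTP]
  intro κ
  induction κ using WellFoundedLT.induction with
  | ind κ ih =>
    rintro s rfl hsP
    by_cases hs : s.Finite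
    · exact hfin s hsP hs
    have : Infinite s := Set.infinite_coe_iff.2 hs
    obtain ⟨_, _, hord⟩ := Cardinal.exists_ord_eq_type_lt s
    let A : s → Set Expr := fun i => (↑) '' Set.Iic i
    have hA_card (i : s) : Cardinal.mk (A i) < Cardinal.mk s :=
      Cardinal.mk_image_le.trans_lt (Cardinal.mk_Iic_lt i hord (Cardinal.aleph0_le_mk s))
    have hA_sub (i : s) : A i ⊆ P := by
      rintro _ ⟨j, -, rfl⟩
      exact hsP j.2
    have hA_mono {i j : s} (hij : i ≤ j) : A i ⊆ A j := Set.image_mono (Set.Iic_subset_Iic.2 hij)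
    have hT (i : s) : ∃ T ∈ Th, A i ⊆ T ∧ T ⊆ P := ih _ (hA_card i) (A i) rfl (hA_sub i)
    let C : s → Set Expr := fun i => ⋂₀ {T | T ∈ Th ∧ A i ⊆ T}
    have hC_mono : Monotone C := fun i j hij =>
      Set.sInter_subset_sInter fun T hT => ⟨hT.1, (hA_mono hij).trans hT.2⟩
    refine ⟨⋃₀ Set.range C, hC _ ?_ (Set.range_nonempty C) hC_mono.isChain_range, ?_, ?_⟩
    · rintro _ ⟨i, rfl⟩
      obtain ⟨T, hTh, hAT, -⟩ := hT i
      exact hA.2 _ (fun T hT => hT.1) ⟨T, hTh, hAT⟩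
    · intro x hx
      exact ⟨_, ⟨⟨x, hx⟩, rfl⟩, fun T hT => hT.2 ⟨⟨x, hx⟩, Set.self_mem_Iic, rfl⟩⟩
    · rintro x ⟨_, ⟨i, rfl⟩, hx⟩
      obtain ⟨T, hTh, hAT, hTP⟩ := hT i
      exact hTP (hx T ⟨hTh, hAT⟩)

theorem isOpen_basicSet {Expr : Type*} (Th : Set (Set Expr)) (a : Expr) :
    IsOpen (basicSet Th a) :=
  TopologicalSpace.isOpen_generateFrom_of_mem ⟨a, rfl⟩

/-- Finitely many expressions, each belonging to some member of an irreducible set of prime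
theories, belong to a common member. -/
theorem IsIrreducible.exists_subset_val {Expr : Type*} {Th : Set (Set Expr)}
    {F : Set (LogicSpace Th)} (hF : IsIrreducible F) {s : Set Expr} (hs : s.Finite)
    (hsF : s ⊆ ⋃ Q ∈ F, Q.val) : ∃ Q ∈ F, s ⊆ Q.val := by
  classical
  obtain ⟨Q, hQF, hQ⟩ := isIrreducible_iff_sInter.1 hF (hs.toFinset.image (basicSet Th))
    (by simp [isOpen_basicSet]) (by
      simp only [Finset.mem_image, Set.Finite.mem_toFinset]
      rintro _ ⟨a, ha, rfl⟩
      obtain ⟨Q, hQF, haQ⟩ := Set.mem_iUnion₂.1 (hsF ha)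
      exact ⟨Q, hQF, haQ⟩)
  exact ⟨Q, hQF, fun a ha => hQ _ (by simpa using ⟨a, ha, rfl⟩)⟩

/-- A prime theory lies in the closure of a set of prime theories if each of its finite subsets is
contained in a member of that set. -/
theorem LogicSpace.mem_closure_of_forall_finite {Expr : Type*} {Th : Set (Set Expr)}
    {F : Set (LogicSpace Th)} {P : LogicSpace Th}
    (h : ∀ s ⊆ P.val, s.Finite → ∃ Q ∈ F, s ⊆ Q.val) : P ∈ closure F := by
  rw [(TopologicalSpace.isTopologicalBasis_of_subbasis (t := inferInstance) rfl).mem_closure_iff]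
  rintro _ ⟨f, ⟨hf, hfsub⟩, rfl⟩ hP
  obtain ⟨s, -, hs, rfl⟩ := Set.exists_subset_image_finite_and.1
    ⟨f, by rwa [Set.image_univ], hf, rfl⟩
  obtain ⟨Q, hQF, hQ⟩ := h s (fun a ha => hP _ ⟨a, ha, rfl⟩) hs
  refine ⟨Q, ?_, hQF⟩
  rintro _ ⟨a, ha, rfl⟩
  exact hQ ha

/-- For a nonempty irreducible closed set `F` in the space of a
distributive abstract logic, the union `P = ⋃ F` of the prime theories in `F`
is itself a prime theory, `P ∈ F`, and `F = closure {P}`, i.e. `P` is a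
generic point of `F`. -/
theorem irreducible_closed_has_generic_point {Expr : Type*} (Th : Set (Set Expr))
    (vee wedge : Expr → Expr → Expr) (hD : IsDistributiveLogic Th vee wedge)
    (F : Set (LogicSpace Th)) (hclosed : IsClosed F) (hirr : IsIrreducible F) :
    ∃ hP : PrimeTheory Th (⋃ Q ∈ F, Q.val),
      (⟨⋃ Q ∈ F, Q.val, hP⟩ : LogicSpace Th) ∈ F ∧
      closure {(⟨⋃ Q ∈ F, Q.val, hP⟩ : LogicSpace Th)} = F := by
  have hfin : ∀ s ⊆ ⋃ Q ∈ F, Q.val, s.Finite → ∃ Q ∈ F, s ⊆ Q.val :=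
    fun s hsF hs => hirr.exists_subset_val hs hsF
  have hTh : (⋃ Q ∈ F, Q.val) ∈ Th := hD.1.mem_of_forall_finite hD.2.1 fun s hsF hs => by
    obtain ⟨Q, hQF, hsQ⟩ := hfin s hsF hs
    exact ⟨Q.val, Q.prime.1, hsQ, Set.subset_biUnion_of_mem (u := LogicSpace.val) hQF⟩
  have hP : PrimeTheory Th (⋃ Q ∈ F, Q.val) := by
    refine ⟨hTh, fun T₁ hT₁ T₂ hT₂ hP => ?_⟩
    by_contra! h
    obtain ⟨a, haT₁, haP⟩ := Set.exists_of_ssubset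
      ((hP.trans_subset Set.inter_subset_left).ssubset_of_ne h.1)
    obtain ⟨b, hbT₂, hbP⟩ := Set.exists_of_ssubset
      ((hP.trans_subset Set.inter_subset_right).ssubset_of_ne h.2)
    have hab : vee a b ∈ ⋃ Q ∈ F, Q.val :=
      hP ▸ ⟨hD.vee_mem hT₁ (Or.inl haT₁), hD.vee_mem hT₂ (Or.inr hbT₂)⟩
    obtain ⟨Q, hQF, habQ⟩ := Set.mem_iUnion₂.1 hab
    rcases hD.mem_or_mem_of_vee_mem Q.prime habQ with haQ | hbQ
    · exact haP (Set.mem_biUnion hQF haQ)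
    · exact hbP (Set.mem_biUnion hQF hbQ)
  have hPF : (⟨⋃ Q ∈ F, Q.val, hP⟩ : LogicSpace Th) ∈ F :=
    hclosed.closure_subset (LogicSpace.mem_closure_of_forall_finite hfin)
  refine ⟨hP, hPF, Set.Subset.antisymm
    (closure_minimal (Set.singleton_subset_iff.2 hPF) hclosed) fun Q hQF => ?_⟩
  exact LogicSpace.mem_closure_of_forall_finite fun s hsQ _ =>
    ⟨_, rfl, hsQ.trans (Set.subset_biUnion_of_mem (u := LogicSpace.val) hQF)⟩
end

section
/- Let ℒ and ℒ' be distributive abstract logics with spaces X = PTh_ℒ and X' = PTh_ℒ', and let h : ℒ → ℒ' be a stable logic map. Define G : X' → X by G(P') = h⁻¹(P'). Then for every a ∈ Expr of ℒ, G⁻¹(a^X) = (h(a))^{X'}; consequently G is a spectral map from X' to X: G is continuous and the preimage under G of every compact open subset belonging to the base Λ(X) is a compact open subset belonging to Λ(X'). -/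
/-- In a chain-closed family, a theory disjoint from `I` extends to a maximal such theory. -/
theorem ChainClosed.exists_maximal_disjoint {Expr : Type*} {Th : Set (Set Expr)}
    (hc : ChainClosed Th) {T I : Set Expr} (hT : T ∈ Th) (hTI : Disjoint T I) :
    ∃ M, T ⊆ M ∧ Maximal (· ∈ {S | S ∈ Th ∧ Disjoint S I}) M := by
  refine zorn_subset_nonempty _ (fun c hcS hchain hne => ?_) T ⟨hT, hTI⟩
  exact ⟨⋃₀ c, ⟨hc c (fun S hS => (hcS hS).1) hne hchain,
    Set.disjoint_sUnion_left.2 fun S hS => (hcS hS).2⟩, fun S hS => Set.subset_sUnion_of_mem hS⟩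

/-- Totally prime theories separate a theory from the expressions outside it. -/
theorem ChainClosed.exists_totallyPrime {Expr : Type*} {Th : Set (Set Expr)}
    (hc : ChainClosed Th) {T : Set Expr} (hT : T ∈ Th) {x : Expr} (hx : x ∉ T) :
    ∃ S, TotallyPrimeTheory Th S ∧ T ⊆ S ∧ x ∉ S := by
  obtain ⟨M, hTM, hM⟩ :=
    hc.exists_maximal_disjoint hT (Set.disjoint_singleton_right.2 hx)
  have hxM : x ∉ M := Set.disjoint_singleton_right.1 hM.prop.2
  refine ⟨M, ⟨hM.prop.1, fun 𝒯 h𝒯 _ hMeq => ?_⟩, hTM, hxM⟩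
  have hx' : ∃ S ∈ 𝒯, x ∉ S := by
    rw [hMeq] at hxM
    simpa using hxM
  obtain ⟨S, hS, hxS⟩ := hx'
  have hMS : M ⊆ S := hMeq ▸ Set.sInter_subset_of_mem hS
  rwa [hM.eq_of_subset ⟨h𝒯 hS, Set.disjoint_singleton_right.2 hxS⟩ hMS]

namespace IsDistributiveLogic

variable {Expr : Type*} {Th : Set (Set Expr)} {vee wedge : Expr → Expr → Expr}

theorem vee_mem_s17 (hD : IsDistributiveLogic Th vee wedge) {T : Set Expr} (hT : T ∈ Th)
    {a b : Expr} (hab : a ∈ T ∨ b ∈ T) : vee a b ∈ T := by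
  by_contra hn
  obtain ⟨S, hS, hTS, hnS⟩ := hD.2.1.exists_totallyPrime hT hn
  exact hnS ((hD.2.2.1 S hS a b).2 (hab.imp (@hTS a) (@hTS b)))

theorem mem_or_mem_of_vee_mem_s17 (hD : IsDistributiveLogic Th vee wedge) {P : Set Expr}
    (hP : PrimeTheory Th P) {a b : Expr} (hab : vee a b ∈ P) : a ∈ P ∨ b ∈ P := by
  by_contra! hn
  obtain ⟨ha, hb⟩ := hn
  have key : ∀ x ∉ P, ∃ S ∈ Th, P ⊆ S ∧ x ∉ S ∧ (a ∈ S ∨ b ∈ S) := fun x hx => by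
    obtain ⟨S, hS, hPS, hxS⟩ := hD.2.1.exists_totallyPrime hP.1 hx
    exact ⟨S, hS.1, hPS, hxS, (hD.2.2.1 S hS a b).1 (hPS hab)⟩
  let above (x : Expr) : Set (Set Expr) := {S | S ∈ Th ∧ P ⊆ S ∧ x ∈ S}
  have hA : (above a).Nonempty := by
    obtain ⟨S, hS, hPS, hbS, h⟩ := key b hb
    exact ⟨S, hS, hPS, h.resolve_right hbS⟩
  have hB : (above b).Nonempty := by
    obtain ⟨S, hS, hPS, haS, h⟩ := key a ha
    exact ⟨S, hS, hPS, h.resolve_left haS⟩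
  have hPeq : P = ⋂₀ above a ∩ ⋂₀ above b := by
    refine Set.Subset.antisymm (Set.subset_inter (Set.subset_sInter fun S hS => hS.2.1)
      (Set.subset_sInter fun S hS => hS.2.1)) fun x hx => ?_
    by_contra hxP
    obtain ⟨S, hS, hPS, hxS, h | h⟩ := key x hxP
    · exact hxS (hx.1 S ⟨hS, hPS, h⟩)
    · exact hxS (hx.2 S ⟨hS, hPS, h⟩)
  rcases hP.2 _ (hD.1.2 _ (fun S hS => hS.1) hA) _ (hD.1.2 _ (fun S hS => hS.1) hB) hPeq with h | h
  · exact ha (h ▸ fun S hS => hS.2.2)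
  · exact hb (h ▸ fun S hS => hS.2.2)

/-- Every basic open set of the space of a distributive abstract logic is compact. -/
theorem isCompact_basicSet (hD : IsDistributiveLogic Th vee wedge) (a : Expr) :
    IsCompact (basicSet Th a) := by
  refine isCompact_generateFrom rfl fun 𝒰 h𝒰 hcover => ?_
  by_contra hn
  let I : Set Expr := {c | ∃ Q ⊆ 𝒰, Q.Finite ∧ basicSet Th c ⊆ ⋃₀ Q}
  have hne : {S | S ∈ Th ∧ a ∈ S}.Nonempty := by
    by_contra hempty
    exact hn ⟨∅, Set.empty_subset _, Set.finite_empty,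
      fun P hP => (hempty ⟨P.val, P.prime.1, hP⟩).elim⟩
  have hdisj : Disjoint (⋂₀ {S | S ∈ Th ∧ a ∈ S}) I := by
    refine Set.disjoint_left.2 fun c hc ⟨Q, hQ, hfin, hcQ⟩ => hn ⟨Q, hQ, hfin, fun P hP => ?_⟩
    exact hcQ (hc P.val ⟨P.prime.1, hP⟩)
  obtain ⟨M, hTM, hM⟩ := hD.2.1.exists_maximal_disjoint
    (hD.1.2 _ (fun S hS => hS.1) hne) hdisj
  have hMI := Set.disjoint_left.1 hM.prop.2
  have hmeet : ∀ S ∈ Th, M ⊆ S → M ≠ S → ∃ c ∈ S, c ∈ I := fun S hS hMS hMne => by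
    by_contra! hc
    exact hMne (hM.eq_of_subset ⟨hS, Set.disjoint_left.2 hc⟩ hMS)
  have hprime : PrimeTheory Th M := by
    refine ⟨hM.prop.1, fun T₁ h₁ T₂ h₂ hMeq => ?_⟩
    by_contra! hne'
    obtain ⟨c, hcT, Q, hQ, hQfin, hcQ⟩ := hmeet T₁ h₁ (hMeq ▸ Set.inter_subset_left) hne'.1
    obtain ⟨d, hdT, R, hR, hRfin, hdR⟩ := hmeet T₂ h₂ (hMeq ▸ Set.inter_subset_right) hne'.2
    refine hMI (a := vee c d) ?_ ⟨Q ∪ R, Set.union_subset hQ hR, hQfin.union hRfin, fun P hP => ?_⟩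
    · rw [hMeq]
      exact ⟨hD.vee_mem_s17 h₁ (.inl hcT), hD.vee_mem_s17 h₂ (.inr hdT)⟩
    · rw [Set.sUnion_union]
      exact (hD.mem_or_mem_of_vee_mem_s17 P.prime hP).imp (@hcQ P) (@hdR P)
  obtain ⟨U, hU, hMU⟩ := hcover (show ⟨M, hprime⟩ ∈ basicSet Th a from hTM fun S hS => hS.2)
  obtain ⟨b, rfl⟩ := h𝒰 hU
  exact hMI hMU ⟨{basicSet Th b}, Set.singleton_subset_iff.2 hU, Set.finite_singleton _, by simp⟩

end IsDistributiveLogic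

/-- For a stable logic map `h : ℒ → ℒ'`, the inverse complement
`G : X' → X`, `G(P') = h⁻¹(P')`, satisfies `G⁻¹(a^X) = (h a)^{X'}`; hence `G`
is a spectral map: it is continuous and preimages of the basic compact opens
in `Λ(X)` are compact opens belonging to `Λ(X')`. -/
theorem inverse_complement_spectral {Expr Expr' : Type*}
    (Th : Set (Set Expr)) (Th' : Set (Set Expr'))
    (vee wedge : Expr → Expr → Expr) (vee' wedge' : Expr' → Expr' → Expr')
    (hD : IsDistributiveLogic Th vee wedge)
    (hD' : IsDistributiveLogic Th' vee' wedge')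
    (h : Expr → Expr') (hmap : ∀ T' ∈ Th', h ⁻¹' T' ∈ Th)
    (hstable : ∀ P' : Set Expr', PrimeTheory Th' P' → PrimeTheory Th (h ⁻¹' P')) :
    ∃ G : LogicSpace Th' → LogicSpace Th,
      (∀ P' : LogicSpace Th', (G P').val = h ⁻¹' P'.val) ∧
      (∀ a : Expr, G ⁻¹' basicSet Th a = basicSet Th' (h a)) ∧
      Continuous G ∧
      (∀ U ∈ Set.range (basicSet Th),
        G ⁻¹' U ∈ Set.range (basicSet Th') ∧ IsOpen (G ⁻¹' U) ∧ IsCompact (G ⁻¹' U)) := by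
  refine ⟨fun P' => ⟨h ⁻¹' P'.val, hstable _ P'.prime⟩, fun _ => rfl, fun _ => rfl,
    continuous_generateFrom_iff.2 ?_, ?_⟩
  · rintro _ ⟨a, rfl⟩
    exact TopologicalSpace.isOpen_generateFrom_of_mem ⟨h a, rfl⟩
  · rintro _ ⟨a, rfl⟩
    exact ⟨⟨h a, rfl⟩, TopologicalSpace.isOpen_generateFrom_of_mem ⟨h a, rfl⟩,
      hD'.isCompact_basicSet (h a)⟩
end
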